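/- arXiv:1102.2547 — 2 statements merged into one kernel-verified Lean document; each statement's English description precedes it below -/
import Mathlib

section
/- The number of vertices (0-dimensional faces) of the Voronoi polytope Vor_Γ equals the number of totally cyclic orientations of Γ∖E_sep. -/
/-!
Serre-style finite graphs: a vertex type `V`, an oriented-edge type `E` with a
fixed-point-free involution `inv` (edge reversal) and source/target maps `s, t`
with `s (inv e) = t e`.  An unoriented edge is an `inv`-orbit `{e, inv e}`;
subsets of unoriented edges are encoded as `inv`-closed subsets of `E`, and an
orientation of a spanning subgraph `Γ∖T` is encoded by the set `O` of its
positively oriented edges.  1-chains with coefficients in `A` are encoded as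
functions `c : E → A` with `c (inv e) = - c e` (so that `(c, e⃗) = c e` for the
standard bilinear form).
-/

structure SerreGraph where
  V : Type
  E : Type
  [fintypeV : Fintype V]
  [fintypeE : Fintype E]
  [decEqV : DecidableEq V]
  [decEqE : DecidableEq E]
  inv : E → E
  s : E → V
  t : E → V
  inv_inv : ∀ e, inv (inv e) = e
  inv_ne : ∀ e, inv e ≠ e
  s_inv : ∀ e, s (inv e) = t e

attribute [instance] SerreGraph.fintypeV SerreGraph.fintypeE
attribute [instance] SerreGraph.decEqV SerreGraph.decEqE

namespace SerreGraph

variable (Γ : SerreGraph)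

/-- Reachability between vertices in the spanning subgraph whose allowed oriented
edges are those in `A`. -/
def Reach (A : Set Γ.E) : Γ.V → Γ.V → Prop :=
  Relation.ReflTransGen (fun a b => ∃ e ∈ A, Γ.s e = a ∧ Γ.t e = b)

/-- The number of connected components of the spanning subgraph with allowed
oriented edges `A`. -/
noncomputable def numComponents (A : Set Γ.E) : ℕ :=
  Nat.card (Quot (fun a b : Γ.V => ∃ e ∈ A, Γ.s e = a ∧ Γ.t e = b))

/-- The set of separating (oriented) edges: removing the underlying unoriented
edge increases the number of connected components. -/
def Esep : Set Γ.E :=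
  {e | Γ.numComponents Set.univ < Γ.numComponents {f | f ≠ e ∧ f ≠ Γ.inv e}}

/-- `T` encodes a set of unoriented edges. -/
def InvClosed (T : Set Γ.E) : Prop := ∀ e, e ∈ T ↔ Γ.inv e ∈ T

/-- `O` is (the set of positively oriented edges of) an orientation of `Γ∖T`. -/
def IsOrientation (T O : Set Γ.E) : Prop :=
  (∀ e ∈ O, e ∉ T) ∧ ∀ e, e ∉ T → (e ∈ O ↔ Γ.inv e ∉ O)

/-- A totally cyclic orientation of `Γ∖T`: an orientation such that there is no
vertex set `W` which is nonempty and proper inside some connected component of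
`Γ∖T` and such that all edges of `Γ∖T` crossing the boundary of `W` are oriented
out of `W` (this is the componentwise condition of the paper). -/
def IsTotallyCyclic (T O : Set Γ.E) : Prop :=
  Γ.IsOrientation T O ∧
    ¬ ∃ W : Set Γ.V, (∃ v ∈ W, ∃ w ∈ Wᶜ, Γ.Reach Tᶜ v w) ∧
        ∀ e ∈ O, Γ.t e ∈ W → Γ.s e ∈ W

/-- `γ` is (the set of positively oriented edges of) an oriented circuit of `Γ`:
a cyclic subgraph (connected, first Betti number one, no separating edges)
together with a totally cyclic orientation; equivalently a directed cycle:
each incident vertex has exactly one outgoing and one incoming edge in `γ`,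
and the support is connected. -/
def IsCircuit (γ : Finset Γ.E) : Prop :=
  γ.Nonempty ∧ (∀ e ∈ γ, Γ.inv e ∉ γ) ∧
    (∀ v ∈ γ.image Γ.s ∪ γ.image Γ.t, ∃! e, e ∈ γ ∧ Γ.s e = v) ∧
    (∀ v ∈ γ.image Γ.s ∪ γ.image Γ.t, ∃! e, e ∈ γ ∧ Γ.t e = v) ∧
    ∀ e ∈ γ, ∀ f ∈ γ, Γ.Reach ((↑γ : Set Γ.E) ∪ Γ.inv '' ↑γ) (Γ.s e) (Γ.s f)

/-- The class `[γ] ∈ H₁(Γ,ℤ)` of an oriented circuit. -/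
def circChainZ (γ : Finset Γ.E) : Γ.E → ℤ :=
  fun e => if e ∈ γ then 1 else if Γ.inv e ∈ γ then -1 else 0

/-- The class `[γ] ∈ H₁(Γ,ℝ)` of an oriented circuit. -/
noncomputable def circChainR (γ : Finset Γ.E) : Γ.E → ℝ :=
  fun e => (Γ.circChainZ γ e : ℝ)

/-- `Cir_φ(Γ∖T)`: oriented circuits of `Γ∖T` compatibly oriented with the
orientation with positive edges `O`. -/
def Cir (T O : Set Γ.E) : Set (Finset Γ.E) :=
  {γ | Γ.IsCircuit γ ∧ (∀ e ∈ γ, e ∈ O) ∧ ∀ e ∈ γ, e ∉ T}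

/-- `c` is a 1-cycle: a skew 1-chain with vanishing boundary, i.e. an element of
`H₁(Γ,A)`. -/
def IsCycle {A : Type*} [AddCommGroup A] (c : Γ.E → A) : Prop :=
  (∀ e, c (Γ.inv e) = - c e) ∧
    ∀ v, ∑ e ∈ Finset.univ.filter (fun e => Γ.t e = v), c e = 0

/-- An element of `H₁(Γ∖T, A) ⊆ H₁(Γ,A)`: a cycle supported on edges not in `T`. -/
def IsCycleOn {A : Type*} [AddCommGroup A] (T : Set Γ.E) (c : Γ.E → A) : Prop :=
  Γ.IsCycle c ∧ ∀ e ∈ T, c e = 0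

/-- The standard positive definite bilinear form on `C⃗₁(Γ,ℝ)`, for which
`(c, e⃗) = c e`. -/
noncomputable def pair (c c' : Γ.E → ℝ) : ℝ := (∑ e, c e * c' e) / 2

/-- The first Betti number `b₁(Γ) = dim_ℝ H₁(Γ,ℝ)`. -/
noncomputable def b1 : ℕ :=
  Module.finrank ℝ (Submodule.span ℝ {c : Γ.E → ℝ | Γ.IsCycle c})

/-- `b₁(Γ∖T) = dim_ℝ H₁(Γ∖T,ℝ)`. -/
noncomputable def b1Sub (T : Set Γ.E) : ℕ :=
  Module.finrank ℝ (Submodule.span ℝ {c : Γ.E → ℝ | Γ.IsCycleOn T c})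

/-- The cone `σ(T,φ) ⊆ H₁(Γ,ℝ)` of the cographic fan associated to a pair
`(T, O)` with `O` an orientation of `Γ∖T`. -/
def sigmaCone (T O : Set Γ.E) : Set (Γ.E → ℝ) :=
  {v | Γ.IsCycle v ∧ (∀ e ∈ O, 0 ≤ v e) ∧ ∀ e ∈ T, v e = 0}

/-- The poset `OP_Γ` of totally cyclic orientations: pairs `(T, O)` with `T` a
set of unoriented edges and `O` a totally cyclic orientation of `Γ∖T`. -/
def OP : Set (Set Γ.E × Set Γ.E) :=
  {p | Γ.InvClosed p.1 ∧ Γ.IsTotallyCyclic p.1 p.2}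

/-- The order on `OP_Γ`: `(T',φ') ≤ (T,φ)` iff `T' ⊇ T` and `φ'` is the
restriction of `φ`. -/
def OPle (p q : Set Γ.E × Set Γ.E) : Prop :=
  q.1 ⊆ p.1 ∧ p.2 = q.2 ∩ p.1ᶜ

/-- `H₁(Γ,ℤ)` viewed as the set of lattice points of `H₁(Γ,ℝ)`. -/
def H1Z : Set (Γ.E → ℝ) := {c | Γ.IsCycle c ∧ ∀ e, ∃ n : ℤ, c e = (n : ℝ)}

/-- The Voronoi polytope `Vor_Γ ⊆ H₁(Γ,ℝ)`. -/
def voronoi : Set (Γ.E → ℝ) :=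
  {v | Γ.IsCycle v ∧ ∀ l ∈ Γ.H1Z, Γ.pair v v ≤ Γ.pair (v - l) (v - l)}

/-- A (exposed) face of the Voronoi polytope. -/
def IsVorFace (F : Set (Γ.E → ℝ)) : Prop :=
  ∃ l : (Γ.E → ℝ) →ₗ[ℝ] ℝ, F = {v | v ∈ Γ.voronoi ∧ ∀ w ∈ Γ.voronoi, l w ≤ l v}

/-- The face `F(T,φ)` of the Voronoi polytope associated to `(T,O) ∈ OP_Γ`. -/
def vorFace (T O : Set Γ.E) : Set (Γ.E → ℝ) :=
  {v | v ∈ Γ.voronoi ∧ ∀ γ ∈ Γ.Cir T O,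
      Γ.pair v (Γ.circChainR γ) = Γ.pair (Γ.circChainR γ) (Γ.circChainR γ) / 2}

end SerreGraph

namespace SerreGraph

variable {Γ : SerreGraph}

section Basic

theorem t_inv (e : Γ.E) : Γ.t (Γ.inv e) = Γ.s e := by
  rw [← Γ.s_inv, Γ.inv_inv]

theorem inv_injective : Function.Injective Γ.inv :=
  Function.LeftInverse.injective Γ.inv_inv

theorem Reach.mono {A B : Set Γ.E} (h : A ⊆ B) {a b : Γ.V} (hab : Γ.Reach A a b) :
    Γ.Reach B a b :=
  Relation.ReflTransGen.mono (fun _ _ ⟨e, he, h'⟩ => ⟨e, h he, h'⟩) _ _ hab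

theorem Reach.step {A : Set Γ.E} {a : Γ.V} {e : Γ.E} (h : Γ.Reach A a (Γ.s e)) (he : e ∈ A) :
    Γ.Reach A a (Γ.t e) :=
  Relation.ReflTransGen.tail h ⟨e, he, rfl, rfl⟩

/-- A subset of vertices closed under the steps of a reachability relation is closed under
reachability. -/
theorem Reach.mem_of_closed {A : Set Γ.E} {W : Set Γ.V}
    (hW : ∀ e ∈ A, Γ.s e ∈ W → Γ.t e ∈ W) {a b : Γ.V} (hab : Γ.Reach A a b) (ha : a ∈ W) :
    b ∈ W := by
  induction hab with
  | refl => exact ha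
  | tail _ h ih =>
    obtain ⟨e, he, rfl, rfl⟩ := h
    exact hW e he ih

/-- Vertices that are the endpoint of a walk of length `n` from `a` along edges in `A`. -/
def reachIn (A : Set Γ.E) (a : Γ.V) : ℕ → Set Γ.V
  | 0 => {a}
  | n + 1 => {v | ∃ e ∈ A, Γ.s e ∈ reachIn A a n ∧ Γ.t e = v}

theorem Reach.exists_reachIn {A : Set Γ.E} {a b : Γ.V} (h : Γ.Reach A a b) :
    ∃ n, b ∈ reachIn A a n := by
  induction h with
  | refl => exact ⟨0, rfl⟩
  | tail _ h ih =>
    obtain ⟨e, he, rfl, rfl⟩ := h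
    obtain ⟨n, hn⟩ := ih
    exact ⟨n + 1, e, he, hn, rfl⟩

end Basic

section Cycles

/-- The submodule of real cycles. -/
def cycles (Γ : SerreGraph) : Submodule ℝ (Γ.E → ℝ) where
  carrier := {c | Γ.IsCycle c}
  zero_mem' := ⟨by simp, by simp⟩
  add_mem' := by
    rintro c d ⟨hc, hc'⟩ ⟨hd, hd'⟩
    refine ⟨fun e => ?_, fun v => ?_⟩
    · simp only [Pi.add_apply, hc, hd]; ring
    · simp only [Pi.add_apply, Finset.sum_add_distrib, hc', hd', add_zero]
  smul_mem' := by
    rintro r c ⟨hc, hc'⟩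
    refine ⟨fun e => ?_, fun v => ?_⟩
    · simp only [Pi.smul_apply, hc, smul_neg]
    · simp only [Pi.smul_apply, ← Finset.smul_sum, hc', smul_zero]

/-- The elementary chain of an oriented edge. -/
def edgeChain (e : Γ.E) : Γ.E → ℝ := fun f => if f = e then 1 else if f = Γ.inv e then -1 else 0

@[simp] theorem edgeChain_self (e : Γ.E) : edgeChain e e = 1 := by simp [edgeChain]

theorem edgeChain_inv (e f : Γ.E) : edgeChain e (Γ.inv f) = -edgeChain e f := by
  have h1 : Γ.inv f = e ↔ f = Γ.inv e :=
    ⟨fun h => by rw [← h, Γ.inv_inv], fun h => by rw [h, Γ.inv_inv]⟩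
  have h2 : Γ.inv f = Γ.inv e ↔ f = e := inv_injective.eq_iff
  have h3 := Γ.inv_ne e
  simp only [edgeChain, h1, h2]
  split_ifs with h h' <;> simp_all

theorem sum_edgeChain (e : Γ.E) (v : Γ.V) :
    ∑ f ∈ Finset.univ.filter (fun f => Γ.t f = v), edgeChain e f =
      (if v = Γ.t e then 1 else 0) - (if v = Γ.s e then 1 else 0) := by
  have h : ∀ f, edgeChain e f = (if f = e then 1 else 0) - (if f = Γ.inv e then 1 else 0) := by
    intro f
    have := Γ.inv_ne e
    simp only [edgeChain]
    split_ifs with h h' <;> simp_all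
  simp only [h, Finset.sum_sub_distrib, Finset.sum_ite_eq', Finset.mem_filter, Finset.mem_univ,
    true_and, t_inv]
  simp only [eq_comm]

/-- A shortest walk from `a` to `v` gives a chain with coefficients `0`, `1`, `-1`. -/
theorem exists_pathChain (A : Set Γ.E) (a : Γ.V) (n : ℕ) (v : Γ.V) (hv : v ∈ reachIn A a n)
    (hmin : ∀ m < n, v ∉ reachIn A a m) :
    ∃ c : Γ.E → ℝ, (∀ f, c (Γ.inv f) = -c f) ∧
      (∀ u, ∑ f ∈ Finset.univ.filter (fun f => Γ.t f = u), c f =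
        (if u = v then 1 else 0) - (if u = a then 1 else 0)) ∧
      (∀ f, c f = -1 ∨ c f = 0 ∨ c f = 1) ∧ (∀ f, f ∉ A → c f ≤ 0) ∧
      ∀ f, 0 < c f → Γ.t f ≠ a ∧ ∃ m ≤ n, Γ.t f ∈ reachIn A a m := by
  induction n generalizing v with
  | zero =>
    obtain rfl : v = a := hv
    exact ⟨0, by simp, by simp, by simp, by simp, by simp⟩
  | succ n ih =>
    obtain ⟨e, he, hs, rfl⟩ := hv
    obtain ⟨c, h1, h2, h3, h4, h5⟩ := ih (Γ.s e) hs fun m hm hm' =>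
      hmin (m + 1) (by omega) ⟨e, he, hm', rfl⟩
    have hce : c e ≤ 0 := by
      by_contra! hpos
      obtain ⟨-, m, hm, hm'⟩ := h5 e hpos
      exact hmin m (by omega) hm'
    have hval : ∀ f, c f + edgeChain e f = -1 ∨ c f + edgeChain e f = 0 ∨
        c f + edgeChain e f = 1 := by
      intro f
      by_cases hf : f = e
      · subst hf
        rw [edgeChain_self]
        rcases h3 f with h | h | h
        · right; left; linarith
        · right; right; linarith
        · linarith
      · by_cases hf' : f = Γ.inv e
        · subst hf'
          rw [edgeChain_inv, edgeChain_self, h1]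
          rcases h3 e with h | h | h
          · right; left; linarith
          · left; linarith
          · linarith
        · simpa [edgeChain, hf, hf'] using h3 f
    have hle : ∀ f, f ≠ e → edgeChain e f ≤ 0 := by
      intro f hf
      simp only [edgeChain, hf, if_false]
      split_ifs <;> norm_num
    refine ⟨c + edgeChain e, fun f => ?_, fun u => ?_, hval, fun f hf => ?_, fun f hf => ?_⟩
    · simp only [Pi.add_apply, h1, edgeChain_inv]; ring
    · simp only [Pi.add_apply, Finset.sum_add_distrib, h2, sum_edgeChain]; ring
    · exact add_nonpos (h4 f hf) (hle f fun h => hf (h ▸ he))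
    · by_cases hfe : f = e
      · subst hfe
        exact ⟨fun h => hmin 0 (by omega) h, n + 1, le_rfl, f, he, hs, rfl⟩
      · have hpos : 0 < c f := by
          have := hle f hfe
          simp only [Pi.add_apply] at hf
          linarith
        obtain ⟨h, m, hm, hm'⟩ := h5 f hpos
        exact ⟨h, m, by omega, hm'⟩

/-- An edge of `A` whose target is joined to its source inside `A` lies on a cycle with
coefficients `0`, `1`, `-1`, positively supported in `A`. -/
theorem exists_unit_cycle {A : Set Γ.E} {e : Γ.E} (he : e ∈ A) (he' : Γ.inv e ∉ A)
    (h : Γ.Reach A (Γ.t e) (Γ.s e)) :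
    ∃ c : Γ.E → ℝ, Γ.IsCycle c ∧ (∀ f, c f = -1 ∨ c f = 0 ∨ c f = 1) ∧
      (∀ f, f ∉ A → c f ≤ 0) ∧ c e = 1 := by
  classical
  have hex := h.exists_reachIn
  obtain ⟨c, h1, h2, h3, h4, h5⟩ := exists_pathChain A (Γ.t e) (Nat.find hex) (Γ.s e)
    (Nat.find_spec hex) fun m hm => Nat.find_min hex hm
  have hce : c e = 0 := by
    have hle : c e ≤ 0 := by
      by_contra! hpos
      exact (h5 e hpos).1 rfl
    have := h4 _ he'
    rw [h1] at this
    linarith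
  refine ⟨c + edgeChain e, ⟨fun f => ?_, fun u => ?_⟩, fun f => ?_, fun f hf => ?_, ?_⟩
  · simp only [Pi.add_apply, h1, edgeChain_inv]; ring
  · simp only [Pi.add_apply, Finset.sum_add_distrib, h2, sum_edgeChain]; ring
  · by_cases hf : f = e
    · subst hf; simp [hce]
    · by_cases hf' : f = Γ.inv e
      · subst hf'
        simp [h1, edgeChain_inv, hce]
      · simpa [edgeChain, hf, hf'] using h3 f
  · refine add_nonpos (h4 f hf) ?_
    have hfe : f ≠ e := fun h => hf (h ▸ he)
    simp only [edgeChain, hfe, if_false]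
    split_ifs <;> norm_num
  · simp [hce]

/-- The total flow of a cycle through a cut vanishes. -/
theorem IsCycle.sum_cut {x : Γ.E → ℝ} (hx : Γ.IsCycle x) (W : Set Γ.V) [DecidablePred (· ∈ W)] :
    ∑ e ∈ Finset.univ.filter (fun e => Γ.t e ∈ W ∧ Γ.s e ∉ W), x e = 0 := by
  have h1 : ∑ e ∈ Finset.univ.filter (fun e => Γ.t e ∈ W), x e = 0 := by
    rw [← Finset.sum_fiberwise_of_maps_to (t := Finset.univ.filter (· ∈ W)) (g := Γ.t)
      (by simp)]
    refine Finset.sum_eq_zero fun v hv => ?_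
    rw [← hx.2 v, Finset.filter_filter]
    refine Finset.sum_congr (Finset.filter_congr fun e _ => ?_) fun _ _ => rfl
    simp only [Finset.mem_filter, Finset.mem_univ, true_and] at hv
    exact ⟨fun h => h.2, fun h => ⟨h ▸ hv, h⟩⟩
  have h2 : ∑ e ∈ Finset.univ.filter (fun e => Γ.t e ∈ W ∧ Γ.s e ∈ W), x e = 0 := by
    have : ∑ e ∈ Finset.univ.filter (fun e => Γ.t e ∈ W ∧ Γ.s e ∈ W), x e =
        ∑ e ∈ Finset.univ.filter (fun e => Γ.t e ∈ W ∧ Γ.s e ∈ W), -x e := by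
      refine Finset.sum_nbij' Γ.inv Γ.inv ?_ ?_ ?_ ?_ ?_
      · simp [t_inv, Γ.s_inv, and_comm]
      · simp [t_inv, Γ.s_inv, and_comm]
      · simp [Γ.inv_inv]
      · simp [Γ.inv_inv]
      · simp [hx.1]
    rw [Finset.sum_neg_distrib] at this
    linarith
  have h3 := Finset.sum_filter_add_sum_filter_not (Finset.univ.filter (fun e => Γ.t e ∈ W))
    (fun e => Γ.s e ∈ W) x
  rw [Finset.filter_filter, Finset.filter_filter, h1, h2, zero_add] at h3
  exact h3

theorem IsCycle.eq_zero_of_cut {x : Γ.E → ℝ} (hx : Γ.IsCycle x) {W : Set Γ.V}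
    (h : ∀ e, Γ.t e ∈ W → Γ.s e ∉ W → 0 ≤ x e) {e : Γ.E} (ht : Γ.t e ∈ W) (hs : Γ.s e ∉ W) :
    x e = 0 := by
  classical
  refine (Finset.sum_eq_zero_iff_of_nonneg fun f hf => ?_).1 (hx.sum_cut W) e (by simp [ht, hs])
  simp only [Finset.mem_filter, Finset.mem_univ, true_and] at hf
  exact h f hf.1 hf.2

theorem IsCycle.neg {x : Γ.E → ℝ} (hx : Γ.IsCycle x) : Γ.IsCycle (-x) :=
  Γ.cycles.neg_mem hx

theorem IsCycle.reach_pos {x : Γ.E → ℝ} (hx : Γ.IsCycle x) {e : Γ.E} (he : 0 < x e) :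
    Γ.Reach {f | 0 < x f} (Γ.t e) (Γ.s e) := by
  by_contra hs
  refine he.ne' (hx.eq_zero_of_cut (W := {v | Γ.Reach {f | 0 < x f} (Γ.t e) v})
    (fun f hf hf' => ?_) Relation.ReflTransGen.refl hs)
  by_contra! hneg
  refine hf' ?_
  have : Γ.Reach {f | 0 < x f} (Γ.t e) (Γ.s (Γ.inv f)) := by rw [Γ.s_inv]; exact hf
  have := this.step (by simp only [Set.mem_ofPred_eq, hx.1]; linarith)
  rwa [t_inv] at this

end Cycles

section Separating

theorem Reach.symm {A : Set Γ.E} (hA : ∀ e ∈ A, Γ.inv e ∈ A) {a b : Γ.V} (h : Γ.Reach A a b) :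
    Γ.Reach A b a := by
  induction h with
  | refl => exact Relation.ReflTransGen.refl
  | tail _ h ih =>
    obtain ⟨e, he, rfl, rfl⟩ := h
    exact Relation.ReflTransGen.head ⟨Γ.inv e, hA e he, Γ.s_inv e, t_inv e⟩ ih

theorem inv_mem_deleted {e f : Γ.E} (hf : f ∈ {f | f ≠ e ∧ f ≠ Γ.inv e}) :
    Γ.inv f ∈ {f | f ≠ e ∧ f ≠ Γ.inv e} :=
  ⟨fun h => hf.2 (by rw [← h, Γ.inv_inv]), fun h => hf.1 (inv_injective h)⟩

theorem mem_Esep_iff (e : Γ.E) :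
    e ∈ Γ.Esep ↔ ¬ Γ.Reach {f | f ≠ e ∧ f ≠ Γ.inv e} (Γ.t e) (Γ.s e) := by
  set A : Set Γ.E := {f | f ≠ e ∧ f ≠ Γ.inv e} with hA
  let r : Set Γ.E → Γ.V → Γ.V → Prop := fun A a b => ∃ e ∈ A, Γ.s e = a ∧ Γ.t e = b
  let q : Quot (r A) → Quot (r Set.univ) :=
    Quot.map id fun _ _ ⟨e, _, h⟩ => ⟨e, Set.mem_univ e, h⟩
  have hq : Function.Surjective q := fun z => by
    induction z using Quot.ind with | _ v => exact ⟨Quot.mk _ v, rfl⟩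
  have hreach : ∀ {a b : Γ.V}, Quot.mk (r A) a = Quot.mk (r A) b → Γ.Reach A a b := by
    intro a b h
    have := Quot.eqvGen_exact h
    clear h
    induction this with
    | rel _ _ h => exact Relation.ReflTransGen.single h
    | refl => exact Relation.ReflTransGen.refl
    | symm _ _ _ ih => exact ih.symm fun f hf => inv_mem_deleted hf
    | trans _ _ _ _ _ ih ih' => exact Relation.ReflTransGen.trans ih ih'
  have hreach' : ∀ {a b : Γ.V}, Γ.Reach A a b → Quot.mk (r A) a = Quot.mk (r A) b := by
    intro a b h
    induction h with
    | refl => rfl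
    | tail _ h ih => exact ih.trans (Quot.sound h)
  have : Finite (Quot (r A)) := Quot.finite _
  have : Finite (Quot (r Set.univ)) := Quot.finite _
  have hle : Nat.card (Quot (r Set.univ)) ≤ Nat.card (Quot (r A)) :=
    Nat.card_le_card_of_surjective q hq
  change Nat.card (Quot (r Set.univ)) < Nat.card (Quot (r A)) ↔ _
  constructor
  · intro hlt h
    refine hlt.not_ge (Nat.card_le_card_of_surjective
      (Quot.lift (fun v => Quot.mk (r A) v) ?_ : Quot (r Set.univ) → Quot (r A)) ?_)
    · rintro _ _ ⟨f, -, rfl, rfl⟩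
      by_cases hf : f ∈ A
      · exact Quot.sound ⟨f, hf, rfl, rfl⟩
      · simp only [hA, Set.mem_ofPred_eq, not_and_or, not_not] at hf
        rcases hf with rfl | rfl
        · exact (hreach' h).symm
        · rw [Γ.s_inv, t_inv]; exact hreach' h
    · intro z
      induction z using Quot.ind with | _ v => exact ⟨Quot.mk _ v, rfl⟩
  · intro h
    refine lt_of_le_of_ne hle fun heq => h (hreach ?_)
    have hinj : Function.Injective q :=
      ((Nat.bijective_iff_surjective_and_card q).2 ⟨hq, heq.symm⟩).1
    exact hinj (Quot.sound ⟨e, Set.mem_univ e, rfl, rfl⟩ :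
      Quot.mk (r Set.univ) (Γ.s e) = Quot.mk (r Set.univ) (Γ.t e)).symm

theorem exists_isCycle_of_notMem_Esep {e : Γ.E} (he : e ∉ Γ.Esep) :
    ∃ c : Γ.E → ℝ, Γ.IsCycle c ∧ c e ≠ 0 := by
  rw [mem_Esep_iff, not_not] at he
  obtain ⟨c, hc, -, -, hce⟩ := exists_unit_cycle (A := {f | f ≠ Γ.inv e})
    (Γ.inv_ne e).symm (by simp) (he.mono fun f hf => hf.2)
  exact ⟨c, hc, by simp [hce]⟩

theorem IsCycle.eq_zero_of_mem_Esep {x : Γ.E → ℝ} (hx : Γ.IsCycle x) {e : Γ.E}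
    (he : e ∈ Γ.Esep) : x e = 0 := by
  rw [mem_Esep_iff] at he
  have key : ∀ y : Γ.E → ℝ, Γ.IsCycle y → 0 ≤ y e → y e = 0 := by
    intro y hy hye
    refine hy.eq_zero_of_cut
      (W := {v | Γ.Reach {f | f ≠ e ∧ f ≠ Γ.inv e} (Γ.t e) v}) (fun f hf hf' => ?_)
      Relation.ReflTransGen.refl he
    by_cases hfe : f = e
    · rwa [hfe]
    by_cases hfe' : f = Γ.inv e
    · subst hfe'
      rw [t_inv] at hf
      exact absurd hf he
    · refine absurd ?_ hf'
      have h : Γ.Reach {f | f ≠ e ∧ f ≠ Γ.inv e} (Γ.t e) (Γ.s (Γ.inv f)) := by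
        rw [Γ.s_inv]; exact hf
      have := h.step (inv_mem_deleted ⟨hfe, hfe'⟩)
      rwa [t_inv] at this
  rcases le_total 0 (x e) with h | h
  · exact key x hx h
  · have := key (-x) hx.neg (by simpa using h)
    simpa using this

theorem inv_mem_Esep {e : Γ.E} : Γ.inv e ∈ Γ.Esep ↔ e ∈ Γ.Esep := by
  have h : {f | f ≠ Γ.inv e ∧ f ≠ Γ.inv (Γ.inv e)} = {f | f ≠ e ∧ f ≠ Γ.inv e} := by
    ext f; simp only [Γ.inv_inv, Set.mem_ofPred_eq, and_comm]
  simp only [Esep, Set.mem_ofPred_eq, h]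

end Separating

section Orientations

theorem IsTotallyCyclic.exists_cycle {O : Set Γ.E} (hO : Γ.IsTotallyCyclic Γ.Esep O) :
    ∃ x : Γ.E → ℝ, Γ.IsCycle x ∧ ∀ e ∈ O, 0 < x e := by
  classical
  obtain ⟨⟨hO1, hO2⟩, hW⟩ := hO
  have hinv : ∀ e ∈ O, Γ.inv e ∉ O := fun e he => (hO2 e (hO1 e he)).1 he
  have hreach : ∀ e ∈ O, Γ.Reach O (Γ.t e) (Γ.s e) := by
    intro e he
    by_contra hs
    refine hW ⟨{v | ¬ Γ.Reach O (Γ.t e) v}, ⟨Γ.s e, hs, Γ.t e, ?_, ?_⟩, ?_⟩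
    · exact not_not_intro Relation.ReflTransGen.refl
    · exact Relation.ReflTransGen.single ⟨e, hO1 e he, rfl, rfl⟩
    · exact fun f hf ht hs' => ht (hs'.step hf)
  choose! c hc _ hneg hone using fun e (he : e ∈ O) => exists_unit_cycle he (hinv e he) (hreach e he)
  refine ⟨∑ e ∈ Finset.univ.filter (· ∈ O), c e,
    Γ.cycles.sum_mem fun e he => hc e (by simpa using he), fun f hf => ?_⟩
  rw [Finset.sum_apply]
  refine Finset.sum_pos' (fun e he => ?_) ⟨f, by simpa using hf, by simp [hone f hf]⟩
  have he' : e ∈ O := by simpa using he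
  have := hneg e he' _ (hinv f hf)
  rw [(hc e he').1] at this
  linarith

theorem IsCycle.isTotallyCyclic {x : Γ.E → ℝ} (hx : Γ.IsCycle x)
    (hne : ∀ e, e ∉ Γ.Esep → x e ≠ 0) : Γ.IsTotallyCyclic Γ.Esep {e | 0 < x e} := by
  refine ⟨⟨fun e he he' => he.ne' (hx.eq_zero_of_mem_Esep he'), fun e he => ?_⟩, ?_⟩
  · simp only [Set.mem_ofPred_eq, hx.1, not_lt]
    exact ⟨fun h => by linarith, fun h => lt_of_le_of_ne (by linarith) (hne e he).symm⟩
  · rintro ⟨W, ⟨v, hv, w, hw, hvw⟩, hW⟩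
    refine hw (hvw.mem_of_closed (fun f hf hs => ?_) hv)
    by_contra ht
    have h0 : (-x) (Γ.inv f) = 0 := by
      refine hx.neg.eq_zero_of_cut (W := W) (fun g hg hg' => ?_) (by rwa [t_inv])
        (by rwa [Γ.s_inv])
      by_contra! hneg
      exact hg' (hW g (by simpa using hneg) hg)
    refine hne f hf ?_
    simpa [hx.1] using h0

/-- The chain `½ ∑_{e ∈ O} e`. -/
noncomputable def halfChain (O : Set Γ.E) : Γ.E → ℝ :=
  open Classical in fun e => if e ∈ O then 1 / 2 else if Γ.inv e ∈ O then -(1 / 2) else 0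

theorem halfChain_of_mem {O : Set Γ.E} {e : Γ.E} (he : e ∈ O) : halfChain O e = 1 / 2 := by
  simp [halfChain, he]

theorem abs_halfChain_le (O : Set Γ.E) (e : Γ.E) : |halfChain O e| ≤ 1 / 2 := by
  unfold halfChain
  split_ifs <;> norm_num [abs_of_pos]

theorem halfChain_mul_le (O : Set Γ.E) (x : Γ.E → ℝ) (e : Γ.E) :
    halfChain O e * x e ≤ 1 / 2 * |x e| :=
  (le_abs_self _).trans <| by
    rw [abs_mul]
    exact mul_le_mul_of_nonneg_right (abs_halfChain_le O e) (abs_nonneg _)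

end Orientations

section Voronoi

theorem pair_add_right (x y z : Γ.E → ℝ) : Γ.pair x (y + z) = Γ.pair x y + Γ.pair x z := by
  simp only [pair, Pi.add_apply, mul_add, Finset.sum_add_distrib]; ring

theorem pair_smul_right (r : ℝ) (x y : Γ.E → ℝ) : Γ.pair x (r • y) = r * Γ.pair x y := by
  simp only [pair, Pi.smul_apply, smul_eq_mul, mul_left_comm _ r, ← Finset.mul_sum]; ring

theorem pair_comm (x y : Γ.E → ℝ) : Γ.pair x y = Γ.pair y x := by
  simp only [pair, mul_comm]

theorem pair_sub_right (x y z : Γ.E → ℝ) : Γ.pair x (y - z) = Γ.pair x y - Γ.pair x z := by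
  simp only [pair, Pi.sub_apply, mul_sub, Finset.sum_sub_distrib]; ring

theorem pair_self_eq_zero {x : Γ.E → ℝ} (h : Γ.pair x x = 0) : x = 0 := by
  have h' : ∑ e, x e * x e = 0 := by unfold pair at h; linarith
  ext e
  simpa using (Finset.sum_eq_zero_iff_of_nonneg fun e _ => mul_self_nonneg (x e)).1 h' e
    (Finset.mem_univ e)

/-- Every linear functional is represented on cycles by pairing with a cycle. -/
theorem exists_cycle_pair_eq (l : (Γ.E → ℝ) →ₗ[ℝ] ℝ) :
    ∃ x, Γ.IsCycle x ∧ ∀ y, Γ.IsCycle y → l y = Γ.pair x y := by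
  let B : Γ.cycles →ₗ[ℝ] Module.Dual ℝ Γ.cycles := LinearMap.mk₂ ℝ
    (fun x y => Γ.pair x y)
    (fun x y z => by simp only [Submodule.coe_add, pair_comm _ (z : Γ.E → ℝ), pair_add_right])
    (fun r x z => by
      simp only [Submodule.coe_smul, pair_comm _ (z : Γ.E → ℝ), pair_smul_right, smul_eq_mul])
    (fun x y z => by simp only [Submodule.coe_add, pair_add_right])
    (fun r x z => by simp only [Submodule.coe_smul, pair_smul_right, smul_eq_mul])
  have hB : Function.Injective B := by
    rw [injective_iff_map_eq_zero]
    intro x hx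
    exact Subtype.ext (pair_self_eq_zero (by simpa [B] using congrArg (fun f => f x) hx))
  have hB' : Function.Surjective B :=
    (LinearMap.injective_iff_surjective_of_finrank_eq_finrank
      Subspace.dual_finrank_eq.symm).1 hB
  obtain ⟨x, hx⟩ := hB' (l ∘ₗ Γ.cycles.subtype)
  exact ⟨x, x.2, fun y hy => by simpa [B] using (congrArg (fun f => f ⟨y, hy⟩) hx).symm⟩

/-- The `ℓ¹`-norm, counting every unoriented edge once. -/
noncomputable def norm1 (x : Γ.E → ℝ) : ℝ := (∑ e, |x e|) / 2

theorem mem_voronoi_iff {v : Γ.E → ℝ} :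
    v ∈ Γ.voronoi ↔ Γ.IsCycle v ∧ ∀ l ∈ Γ.H1Z, Γ.pair v l ≤ Γ.pair l l / 2 := by
  refine and_congr_right fun _ => forall₂_congr fun l _ => ?_
  have : Γ.pair (v - l) (v - l) = Γ.pair v v - 2 * Γ.pair v l + Γ.pair l l := by
    rw [pair_sub_right, pair_comm _ v, pair_comm _ l, pair_sub_right, pair_sub_right,
      pair_comm l v]
    ring
  rw [this]
  constructor <;> intro h <;> linarith

theorem pair_halfChain_le (O : Set Γ.E) (x : Γ.E → ℝ) :
    Γ.pair (halfChain O) x ≤ norm1 x / 2 := by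
  have := Finset.sum_le_sum fun e (_ : e ∈ Finset.univ) => halfChain_mul_le O x e
  rw [← Finset.mul_sum] at this
  unfold pair norm1
  linarith

theorem norm1_le_pair_self {l : Γ.E → ℝ} (hl : ∀ e, ∃ n : ℤ, l e = n) :
    norm1 l ≤ Γ.pair l l := by
  unfold norm1 pair
  refine div_le_div_of_nonneg_right (Finset.sum_le_sum fun e _ => ?_) (by norm_num)
  obtain ⟨n, hn⟩ := hl e
  rw [hn]
  have : |n| ≤ n * n := by
    rw [← abs_mul_abs_self n]
    rcases (abs_nonneg n).eq_or_lt with h | h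
    · simp [← h]
    · nlinarith [Int.add_one_le_iff.2 h]
  exact_mod_cast this

/-- A nonzero cycle majorizes a cycle with coefficients `0`, `1`, `-1` with compatible signs. -/
theorem IsCycle.exists_reduction {x : Γ.E → ℝ} (hx : Γ.IsCycle x) (hx0 : x ≠ 0) :
    ∃ c : Γ.E → ℝ, ∃ m : ℝ, Γ.IsCycle c ∧ (∀ f, c f = -1 ∨ c f = 0 ∨ c f = 1) ∧ 0 ≤ m ∧
      (∀ f, |x f| = |(x - m • c) f| + m * |c f|) ∧
      ∃ f, x f ≠ 0 ∧ (x - m • c) f = 0 := by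
  classical
  obtain ⟨e, he⟩ : ∃ e, 0 < x e := by
    obtain ⟨e, he⟩ := Function.ne_iff.1 hx0
    rcases lt_or_gt_of_ne he with h | h
    · exact ⟨Γ.inv e, by rw [hx.1]; simpa using h⟩
    · exact ⟨e, h⟩
  obtain ⟨c, hc, hval, hneg, hce⟩ := exists_unit_cycle (A := {f | 0 < x f}) he
    (by simp only [Set.mem_ofPred_eq, hx.1]; linarith) (hx.reach_pos he)
  obtain ⟨f, hf, hmin⟩ := Finset.exists_min_image (Finset.univ.filter fun f => c f = 1) x
    ⟨e, by simp [hce]⟩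
  simp only [Finset.mem_filter, Finset.mem_univ, true_and] at hf hmin
  have hpos : ∀ g, c g = 1 → 0 < x g := by
    intro g hg
    by_contra h
    have := hneg g h
    linarith
  have hle : ∀ g, c g = 1 → |x g| = |(x - x f • c) g| + x f * |c g| := by
    intro g hg
    have := hmin g hg
    simp only [Pi.sub_apply, Pi.smul_apply, smul_eq_mul, hg, mul_one, abs_one]
    rw [abs_of_pos (hpos g hg), abs_of_nonneg (by linarith)]
    ring
  refine ⟨c, x f, hc, hval, (hpos f hf).le, fun g => ?_, f, (hpos f hf).ne', by simp [hf]⟩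
  rcases hval g with h | h | h
  · have := hle (Γ.inv g) (by rw [hc.1, h, neg_neg])
    simp only [Pi.sub_apply, Pi.smul_apply, smul_eq_mul, hx.1, hc.1, abs_neg, mul_neg] at this ⊢
    rw [this, ← abs_neg]
    ring_nf
  · simp [h]
  · exact hle g h

theorem pair_le_of_mem_voronoi {w : Γ.E → ℝ} (hw : w ∈ Γ.voronoi) {x : Γ.E → ℝ}
    (hx : Γ.IsCycle x) : Γ.pair w x ≤ norm1 x / 2 := by
  classical
  induction hn : (Finset.univ.filter fun e => x e ≠ 0).card using Nat.strong_induction_on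
    generalizing x with
  | _ n ih =>
    by_cases hx0 : x = 0
    · simp [hx0, pair, norm1]
    obtain ⟨c, m, hc, hval, hm, habs, f, hf, hf'⟩ := hx.exists_reduction hx0
    have hint : ∀ e, ∃ n : ℤ, c e = n := by
      intro e
      rcases hval e with h | h | h
      · exact ⟨-1, by simp [h]⟩
      · exact ⟨0, by simp [h]⟩
      · exact ⟨1, by simp [h]⟩
    have hcc : Γ.pair c c = norm1 c := by
      unfold pair norm1
      congr 1
      refine Finset.sum_congr rfl fun e _ => ?_
      rcases hval e with h | h | h <;> simp [h]
    have h1 : Γ.pair w c ≤ norm1 c / 2 := hcc ▸ (mem_voronoi_iff.1 hw).2 c ⟨hc, hint⟩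
    have h2 : Γ.pair w (x - m • c) ≤ norm1 (x - m • c) / 2 := by
      refine ih _ ?_ (Γ.cycles.sub_mem hx (Γ.cycles.smul_mem m hc)) rfl
      rw [← hn]
      refine Finset.card_lt_card (Finset.ssubset_iff_of_subset ?_ |>.2 ⟨f, by simpa using hf, ?_⟩)
      · intro g
        simp only [Finset.mem_filter, Finset.mem_univ, true_and]
        intro hg hxg
        have hg' := habs g
        rw [hxg, abs_zero] at hg'
        have := abs_pos.2 hg
        have := mul_nonneg hm (abs_nonneg (c g))
        linarith
      · simpa using hf'
    have h3 : norm1 x = norm1 (x - m • c) + m * norm1 c := by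
      unfold norm1
      rw [Finset.sum_congr rfl fun g _ => habs g, Finset.sum_add_distrib, ← Finset.mul_sum]
      ring
    rw [pair_sub_right, pair_smul_right] at h2
    have := mul_le_mul_of_nonneg_left h1 hm
    linarith

/-- The orthogonal projection to `H₁(Γ,ℝ)` of `½ ∑_{e ∈ O} e`. -/
theorem exists_vertex (O : Set Γ.E) :
    ∃ v, Γ.IsCycle v ∧ ∀ y, Γ.IsCycle y → Γ.pair v y = Γ.pair (halfChain O) y := by
  obtain ⟨x, hx, h⟩ := exists_cycle_pair_eq (Γ := Γ)
    { toFun := fun y => Γ.pair (halfChain O) y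
      map_add' := pair_add_right _
      map_smul' := fun r y => pair_smul_right r _ y }
  exact ⟨x, hx, fun y hy => (h y hy).symm⟩

/-- The vertex of the Voronoi polytope attached to an orientation. -/
noncomputable def vertex (O : Set Γ.E) : Γ.E → ℝ := (exists_vertex O).choose

theorem isCycle_vertex (O : Set Γ.E) : Γ.IsCycle (vertex O) := (exists_vertex O).choose_spec.1

theorem pair_vertex (O : Set Γ.E) {y : Γ.E → ℝ} (hy : Γ.IsCycle y) :
    Γ.pair (vertex O) y = Γ.pair (halfChain O) y := (exists_vertex O).choose_spec.2 y hy

theorem vertex_mem_voronoi (O : Set Γ.E) : vertex O ∈ Γ.voronoi := by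
  refine mem_voronoi_iff.2 ⟨isCycle_vertex O, fun l hl => ?_⟩
  rw [pair_vertex O hl.1]
  have := pair_halfChain_le O l
  have := norm1_le_pair_self hl.2
  linarith

/-- `halfChain O` pairs maximally with the cycles that are nonnegative on the orientation `O`. -/
theorem IsOrientation.pair_halfChain {O : Set Γ.E} (hO : Γ.IsOrientation Γ.Esep O) {x : Γ.E → ℝ}
    (hx : Γ.IsCycle x) (hpos : ∀ e ∈ O, 0 ≤ x e) : Γ.pair (halfChain O) x = norm1 x / 2 := by
  have : ∀ e, halfChain O e * x e = 1 / 2 * |x e| := by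
    intro e
    by_cases he : e ∈ O
    · rw [halfChain_of_mem he, abs_of_nonneg (hpos e he)]
    by_cases he' : e ∈ Γ.Esep
    · simp [hx.eq_zero_of_mem_Esep he']
    · have hi : Γ.inv e ∈ O := by
        by_contra h
        exact he ((hO.2 e he').2 h)
      have := hpos _ hi
      rw [hx.1] at this
      rw [abs_of_nonpos (by linarith)]
      simp [halfChain, he, hi]
  simp only [pair, norm1, this, ← Finset.mul_sum]
  ring

/-- Adding a small multiple of `y` to `x` does not change the signs of `x`. -/
theorem exists_perturbation (x y : Γ.E → ℝ) : ∃ ε > 0, ∀ e, x e ≠ 0 → ε * |y e| < |x e| := by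
  have h : ∀ e, ∀ᶠ ε in nhdsWithin (0 : ℝ) (Set.Ioi 0), x e ≠ 0 → ε * |y e| < |x e| := by
    intro e
    by_cases hx : x e = 0
    · simp [hx]
    have ht : Filter.Tendsto (fun ε : ℝ => ε * |y e|) (nhdsWithin 0 (Set.Ioi 0)) (nhds 0) := by
      have : Continuous fun ε : ℝ => ε * |y e| := by fun_prop
      simpa using (this.tendsto 0).mono_left nhdsWithin_le_nhds
    filter_upwards [ht.eventually (gt_mem_nhds (abs_pos.2 hx))] with ε h _ using h
  obtain ⟨ε, h1, h2⟩ := ((Filter.eventually_all.2 h).and self_mem_nhdsWithin).exists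
  exact ⟨ε, h2, h1⟩

theorem eq_vertex_of_pair_eq {O : Set Γ.E} (hO : Γ.IsOrientation Γ.Esep O) {x : Γ.E → ℝ}
    (hx : Γ.IsCycle x) (hpos : ∀ e ∈ O, 0 < x e) {w : Γ.E → ℝ} (hw : w ∈ Γ.voronoi)
    (h : Γ.pair w x = norm1 x / 2) : w = vertex O := by
  have key : ∀ y, Γ.IsCycle y → Γ.pair w y ≤ Γ.pair (vertex O) y := by
    intro y hy
    obtain ⟨ε, hε, hε'⟩ := exists_perturbation x y
    have hxy : Γ.IsCycle (x + ε • y) := Γ.cycles.add_mem hx (Γ.cycles.smul_mem ε hy)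
    have h1 := pair_le_of_mem_voronoi hw hxy
    rw [← hO.pair_halfChain hxy, pair_add_right, pair_add_right, pair_smul_right, pair_smul_right,
      h, hO.pair_halfChain hx fun e he => (hpos e he).le] at h1
    · rw [pair_vertex O hy]
      exact le_of_mul_le_mul_left (by linarith) hε
    · intro e he
      have h2 := hε' e (hpos e he).ne'
      rw [abs_of_pos (hpos e he)] at h2
      have := mul_le_mul_of_nonneg_left (neg_abs_le (y e)) hε.le
      simp only [Pi.add_apply, Pi.smul_apply, smul_eq_mul]
      linarith
  have hd : Γ.IsCycle (w - vertex O) := Γ.cycles.sub_mem hw.1 (isCycle_vertex O)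
  have h1 := key _ hd
  have h2 : Γ.pair (w - vertex O) (w - vertex O) ≤ 0 := by
    rw [pair_comm w, pair_comm (vertex O)] at h1
    rw [pair_sub_right]
    linarith
  have h3 : 0 ≤ Γ.pair (w - vertex O) (w - vertex O) :=
    div_nonneg (Finset.sum_nonneg fun e _ => mul_self_nonneg _) (by norm_num)
  exact sub_eq_zero.1 (pair_self_eq_zero (le_antisymm h2 h3))

theorem IsTotallyCyclic.isVorFace_vertex {O : Set Γ.E} (hO : Γ.IsTotallyCyclic Γ.Esep O) :
    Γ.IsVorFace {vertex O} := by
  obtain ⟨x, hx, hpos⟩ := hO.exists_cycle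
  have hv : Γ.pair (vertex O) x = norm1 x / 2 := by
    rw [pair_vertex O hx, hO.1.pair_halfChain hx fun e he => (hpos e he).le]
  refine ⟨{ toFun := fun y => Γ.pair x y
            map_add' := pair_add_right _
            map_smul' := fun r y => pair_smul_right r _ y }, ?_⟩
  ext v
  simp only [Set.mem_singleton_iff, Set.mem_ofPred_eq, LinearMap.coe_mk, AddHom.coe_mk,
    pair_comm x]
  constructor
  · rintro rfl
    exact ⟨vertex_mem_voronoi O, fun w hw => hv ▸ pair_le_of_mem_voronoi hw hx⟩
  · rintro ⟨hv1, hv2⟩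
    exact eq_vertex_of_pair_eq hO.1 hx hpos hv1
      (le_antisymm (pair_le_of_mem_voronoi hv1 hx) (hv ▸ hv2 _ (vertex_mem_voronoi O)))

theorem IsTotallyCyclic.subset_of_vertex_eq {O O' : Set Γ.E} (hO : Γ.IsTotallyCyclic Γ.Esep O)
    (h : vertex O = vertex O') (hO' : Γ.IsOrientation Γ.Esep O') : O ⊆ O' := by
  obtain ⟨x, hx, hpos⟩ := hO.exists_cycle
  intro e he
  by_contra he'
  have h1 : Γ.pair (halfChain O') x = norm1 x / 2 := by
    rw [← pair_vertex O' hx, ← h, pair_vertex O hx,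
      hO.1.pair_halfChain hx fun e he => (hpos e he).le]
  have hi : Γ.inv e ∈ O' := by
    by_contra hi
    exact he' ((hO'.2 e (hO.1.1 e he)).2 hi)
  have h2 : ∑ f, halfChain O' f * x f < ∑ f, 1 / 2 * |x f| := by
    refine Finset.sum_lt_sum (fun f _ => halfChain_mul_le O' x f) ⟨e, Finset.mem_univ e, ?_⟩
    have := hpos e he
    rw [abs_of_pos this]
    simp only [halfChain, he', hi, if_true, if_false]
    linarith
  rw [← Finset.mul_sum] at h2
  unfold pair norm1 at h1
  linarith

/-- Some cycle is nonzero on every nonseparating edge. -/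
theorem exists_generic_cycle (Γ : SerreGraph) :
    ∃ z : Γ.E → ℝ, Γ.IsCycle z ∧ ∀ e, e ∉ Γ.Esep → z e ≠ 0 := by
  classical
  suffices h : ∀ S : Finset Γ.E, (∀ e ∈ S, e ∉ Γ.Esep) →
      ∃ z : Γ.E → ℝ, Γ.IsCycle z ∧ ∀ e ∈ S, z e ≠ 0 by
    obtain ⟨z, hz, hz'⟩ := h (Finset.univ.filter (· ∉ Γ.Esep)) (by simp)
    exact ⟨z, hz, fun e he => hz' e (by simpa using he)⟩
  intro S
  induction S using Finset.induction_on with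
  | empty => exact fun _ => ⟨0, Γ.cycles.zero_mem, by simp⟩
  | insert a S _ ih =>
    intro hS
    obtain ⟨z, hz, hz'⟩ := ih fun e he => hS e (Finset.mem_insert_of_mem he)
    obtain ⟨c, hc, hca⟩ := exists_isCycle_of_notMem_Esep (hS a (Finset.mem_insert_self a S))
    obtain ⟨ε, hε, hε'⟩ := exists_perturbation z c
    have hne : ∀ e, z e ≠ 0 → (z + ε • c) e ≠ 0 := by
      intro e he h0
      have h1 := hε' e he
      simp only [Pi.add_apply, Pi.smul_apply, smul_eq_mul] at h0
      rw [eq_neg_of_add_eq_zero_left h0, abs_neg, abs_mul, abs_of_pos hε] at h1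
      exact lt_irrefl _ h1
    refine ⟨z + ε • c, Γ.cycles.add_mem hz (Γ.cycles.smul_mem ε hc), fun e he => ?_⟩
    by_cases hze : z e = 0
    · rcases Finset.mem_insert.1 he with rfl | he
      · simp [hze, hε.ne', hca]
      · exact absurd hze (hz' e he)
    · exact hne e hze

/-- Every cycle is nonnegative on some totally cyclic orientation. -/
theorem IsCycle.exists_totallyCyclic {x : Γ.E → ℝ} (hx : Γ.IsCycle x) :
    ∃ O, Γ.IsTotallyCyclic Γ.Esep O ∧ ∀ e ∈ O, 0 ≤ x e := by
  obtain ⟨z, hz, hz'⟩ := exists_generic_cycle Γ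
  obtain ⟨ε, hε, hε'⟩ := exists_perturbation x z
  have hxz : Γ.IsCycle (x + ε • z) := Γ.cycles.add_mem hx (Γ.cycles.smul_mem ε hz)
  refine ⟨_, hxz.isTotallyCyclic fun e he h0 => ?_, fun e he => ?_⟩
  · simp only [Pi.add_apply, Pi.smul_apply, smul_eq_mul] at h0
    by_cases hxe : x e = 0
    · simp [hxe, hε.ne', hz' e he] at h0
    · have h1 := hε' e hxe
      rw [eq_neg_of_add_eq_zero_left h0, abs_neg, abs_mul, abs_of_pos hε] at h1
      exact lt_irrefl _ h1
  · by_contra! hneg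
    have h1 := hε' e hneg.ne
    rw [abs_of_neg hneg] at h1
    have := mul_le_mul_of_nonneg_left (le_abs_self (z e)) hε.le
    simp only [Set.mem_ofPred_eq, Pi.add_apply, Pi.smul_apply, smul_eq_mul] at he
    linarith

theorem IsVorFace.exists_eq_vertex {p : Γ.E → ℝ} (h : Γ.IsVorFace {p}) :
    ∃ O, Γ.IsTotallyCyclic Γ.Esep O ∧ p = vertex O := by
  obtain ⟨l, hl⟩ := h
  obtain ⟨x, hx, hlx⟩ := exists_cycle_pair_eq l
  obtain ⟨O, hO, hpos⟩ := hx.exists_totallyCyclic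
  refine ⟨O, hO, ?_⟩
  have hmem : vertex O ∈ ({p} : Set (Γ.E → ℝ)) := by
    rw [hl]
    refine ⟨vertex_mem_voronoi O, fun w hw => ?_⟩
    rw [hlx w hw.1, hlx _ (isCycle_vertex O), pair_comm x, pair_comm x, pair_vertex O hx,
      hO.1.pair_halfChain hx hpos]
    exact pair_le_of_mem_voronoi hw hx
  exact hmem.symm

end Voronoi

end SerreGraph

/-- The number of vertices (0-dimensional faces) of the
Voronoi polytope equals the number of totally cyclic orientations of
`Γ∖E_sep`. -/
theorem stmt14 (Γ : SerreGraph) :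
    Nat.card {F : Set (Γ.E → ℝ) // Γ.IsVorFace F ∧ ∃ x, F = {x}} =
      Nat.card {O : Set Γ.E // Γ.IsTotallyCyclic Γ.Esep O} := by
  refine (Nat.card_congr (Equiv.ofBijective
    (fun O : {O : Set Γ.E // Γ.IsTotallyCyclic Γ.Esep O} =>
      (⟨{SerreGraph.vertex O.1}, O.2.isVorFace_vertex, _, rfl⟩ :
        {F : Set (Γ.E → ℝ) // Γ.IsVorFace F ∧ ∃ x, F = {x}})) ⟨?_, ?_⟩)).symm
  · rintro ⟨O, hO⟩ ⟨O', hO'⟩ h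
    have h' : SerreGraph.vertex O = SerreGraph.vertex O' :=
      Set.singleton_injective (Subtype.mk.inj h)
    exact Subtype.ext ((hO.subset_of_vertex_eq h' hO'.1).antisymm
      (hO'.subset_of_vertex_eq h'.symm hO.1))
  · rintro ⟨_, hF, p, rfl⟩
    obtain ⟨O, hO, rfl⟩ := hF.exists_eq_vertex
    exact ⟨⟨O, hO⟩, rfl⟩
end

section
/- For every (T,φ) ∈ OP_Γ, the set H := {[γ] : γ ∈ Cir_φ(Γ∖T)} is the Hilbert basis of the affine semigroup C(Γ∖T,φ) := σ(T,φ) ∩ H₁(Γ,ℤ): every element of C(Γ∖T,φ) is an ℕ-linear combination of elements of H, and no element of H can be written as the sum of two nonzero elements of C(Γ∖T,φ). -/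
namespace SerreGraph

variable {Γ : SerreGraph}

/-- At a vertex of a circuit, the boundary of a chain supported on the circuit is the value on
the incoming edge plus the value on the reversed outgoing edge. -/
theorem IsCircuit.sum_eq {γ : Finset Γ.E} (hγ : Γ.IsCircuit γ) {a : Γ.E → ℤ}
    (ha : ∀ e, e ∉ γ → Γ.inv e ∉ γ → a e = 0) {e f : Γ.E} (he : e ∈ γ) (hf : f ∈ γ)
    (hef : Γ.t e = Γ.s f) :
    ∑ h ∈ Finset.univ.filter (fun h => Γ.t h = Γ.t e), a h = a e + a (Γ.inv f) := by
  obtain ⟨-, hinv, hout, hin, -⟩ := hγ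
  have hv : Γ.t e ∈ γ.image Γ.s ∪ γ.image Γ.t :=
    Finset.mem_union_right _ (Finset.mem_image_of_mem _ he)
  refine Finset.sum_eq_add e (Γ.inv f) ?_ ?_ ?_ ?_
  · rintro rfl
    exact hinv f hf he
  · intro h hh hne
    have ht : Γ.t h = Γ.t e := by simpa using hh
    refine ha h (fun hmem => hne.1 ?_) (fun hmem => hne.2 ?_)
    · exact (hin _ hv).unique ⟨hmem, ht⟩ ⟨he, rfl⟩
    · have : Γ.inv h = f :=
        (hout _ hv).unique ⟨hmem, by rw [Γ.s_inv, ht]⟩ ⟨hf, hef.symm⟩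
      rw [← this, Γ.inv_inv]
  · intro h
    exact absurd (by simp) h
  · intro h
    exact absurd (by simp [t_inv, hef]) h

theorem IsCircuit.isCycle_circChainZ {γ : Finset Γ.E} (hγ : Γ.IsCircuit γ) :
    Γ.IsCycle (Γ.circChainZ γ) := by
  have hinv := hγ.2.1
  refine ⟨fun e => ?_, fun v => ?_⟩
  · have := hinv e
    by_cases h1 : e ∈ γ <;> by_cases h2 : Γ.inv e ∈ γ <;>
      simp_all [circChainZ, Γ.inv_inv]
  · by_cases hv : v ∈ γ.image Γ.s ∪ γ.image Γ.t
    · obtain ⟨e, ⟨he, rfl⟩, -⟩ := hγ.2.2.2.1 v hv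
      obtain ⟨f, ⟨hf, hfe⟩, -⟩ := hγ.2.2.1 _ hv
      rw [hγ.sum_eq (fun e h1 h2 => by simp [circChainZ, h1, h2]) he hf hfe.symm]
      simp [circChainZ, he, hf, hinv f hf, Γ.inv_inv]
    · refine Finset.sum_eq_zero fun e he => ?_
      have ht : Γ.t e = v := by simpa using he
      have h1 : e ∉ γ := fun h =>
        hv (Finset.mem_union_right _ (Finset.mem_image.2 ⟨e, h, ht⟩))
      have h2 : Γ.inv e ∉ γ := fun h =>
        hv (Finset.mem_union_left _ (Finset.mem_image.2 ⟨_, h, by rw [Γ.s_inv, ht]⟩))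
      simp [circChainZ, h1, h2]

/-- A cycle supported on a circuit is constant along it. -/
theorem IsCircuit.eq_of_isCycle {γ : Finset Γ.E} (hγ : Γ.IsCircuit γ) {a : Γ.E → ℤ}
    (hc : Γ.IsCycle a) (ha : ∀ e, e ∉ γ → Γ.inv e ∉ γ → a e = 0) {e f : Γ.E}
    (he : e ∈ γ) (hf : f ∈ γ) : a f = a e := by
  have step : ∀ e ∈ γ, ∀ f ∈ γ, Γ.t e = Γ.s f → a f = a e := by
    intro e he f hf hef
    have := hγ.sum_eq ha he hf hef
    rw [hc.2, hc.1] at this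
    linarith
  have hout := hγ.2.2.1
  suffices H : ∀ w, Γ.Reach ((↑γ : Set Γ.E) ∪ Γ.inv '' ↑γ) (Γ.s e) w →
      ∀ f ∈ γ, Γ.s f = w → a f = a e from H _ (hγ.2.2.2.2 e he f hf) f hf rfl
  intro w hw
  induction hw with
  | refl =>
    intro f hf hs
    rw [(hout (Γ.s e) (Finset.mem_union_left _ (Finset.mem_image_of_mem _ he))).unique
      ⟨hf, hs⟩ ⟨he, rfl⟩]
  | tail _ hstep ih =>
    intro f hf hs
    obtain ⟨h, hh, rfl, rfl⟩ := hstep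
    rcases hh with hh | ⟨k, hk, rfl⟩
    · rw [step h hh f hf hs.symm, ih h hh rfl]
    · rw [t_inv] at hs
      have hfk : f = k :=
        (hout (Γ.s k) (Finset.mem_union_left _ (Finset.mem_image_of_mem _ hk))).unique
          ⟨hf, hs⟩ ⟨hk, rfl⟩
      subst hfk
      obtain ⟨g, ⟨hg, hgs⟩, -⟩ :=
        hout (Γ.t f) (Finset.mem_union_right _ (Finset.mem_image_of_mem _ hf))
      rw [← step f hf g hg hgs.symm]
      exact ih g hg (by rw [hgs, Γ.s_inv])

/-- A nonempty set of oriented edges containing no edge together with its reverse, in which every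
edge can be continued, contains a circuit. -/
theorem exists_isCircuit_subset {P : Finset Γ.E} (hP : P.Nonempty)
    (hinv : ∀ e ∈ P, Γ.inv e ∉ P) (hnext : ∀ e ∈ P, ∃ f ∈ P, Γ.s f = Γ.t e) :
    ∃ γ ⊆ P, Γ.IsCircuit γ := by
  have : Nonempty Γ.E := ⟨hP.choose⟩
  have hg : ∀ v, ∃ g : Γ.E, (∃ f ∈ P, Γ.s f = v) → g ∈ P ∧ Γ.s g = v := by
    intro v
    by_cases h : ∃ f ∈ P, Γ.s f = v
    · exact ⟨h.choose, fun _ => h.choose_spec⟩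
    · exact ⟨Classical.arbitrary _, fun h' => absurd h' h⟩
  choose g hg using hg
  have hF : ∀ e ∈ P, g (Γ.t e) ∈ P ∧ Γ.s (g (Γ.t e)) = Γ.t e := fun e he =>
    hg _ (hnext e he)
  obtain ⟨γ, hγ⟩ := exists_minimal_of_wellFoundedLT
    (fun S : Finset Γ.E => S.Nonempty ∧ S ⊆ P ∧ ∀ e ∈ S, g (Γ.t e) ∈ S)
    ⟨P, hP, subset_rfl, fun e he => (hF e he).1⟩
  obtain ⟨⟨hne, hsub, hmaps⟩, hmin⟩ := hγ
  have himage : γ.image (fun e => g (Γ.t e)) = γ := by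
    have hle : γ.image (fun e => g (Γ.t e)) ⊆ γ := Finset.image_subset_iff.2 hmaps
    refine hle.antisymm (hmin ⟨hne.image _, hle.trans hsub, fun e he => ?_⟩ hle)
    exact Finset.mem_image_of_mem (fun e => g (Γ.t e)) (hle he)
  have hinj : Set.InjOn (fun e => g (Γ.t e)) (γ : Set Γ.E) :=
    Finset.card_image_iff.1 (by rw [himage])
  have hprev : ∀ e ∈ γ, ∃ f ∈ γ, g (Γ.t f) = e := by
    intro e he
    rw [← himage] at he
    simpa using he
  have hgs : ∀ e ∈ γ, g (Γ.s e) = e := by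
    intro e he
    obtain ⟨f, hf, rfl⟩ := hprev e he
    rw [(hF f (hsub hf)).2]
  refine ⟨γ, hsub, hne, fun e he h => hinv e (hsub he) (hsub h), ?_, ?_, ?_⟩
  · intro v hv
    refine existsUnique_of_exists_of_unique ?_ ?_
    · rcases Finset.mem_union.1 hv with h | h
      · simpa using h
      · obtain ⟨e, he, rfl⟩ := Finset.mem_image.1 h
        exact ⟨_, hmaps e he, (hF e (hsub he)).2⟩
    · rintro e f ⟨he, rfl⟩ ⟨hf, hs⟩
      rw [← hgs e he, ← hgs f hf, hs]
  · intro v hv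
    refine existsUnique_of_exists_of_unique ?_ ?_
    · rcases Finset.mem_union.1 hv with h | h
      · obtain ⟨e, he, rfl⟩ := Finset.mem_image.1 h
        obtain ⟨f, hf, rfl⟩ := hprev e he
        exact ⟨f, hf, (hF f (hsub hf)).2.symm⟩
      · simpa using h
    · rintro e f ⟨he, rfl⟩ ⟨hf, hs⟩
      exact hinj he hf (by simp only [hs])
  · intro e he f hf
    classical
    let R : Finset Γ.E := γ.filter fun h =>
      Γ.Reach ((↑γ : Set Γ.E) ∪ Γ.inv '' ↑γ) (Γ.s e) (Γ.s h)
    have hR : γ ⊆ R := by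
      refine hmin ⟨⟨e, ?_⟩, (Finset.filter_subset _ _).trans hsub, fun h hh => ?_⟩
        (Finset.filter_subset _ _)
      · exact Finset.mem_filter.2 ⟨he, Relation.ReflTransGen.refl⟩
      · obtain ⟨hh, hr⟩ := Finset.mem_filter.1 hh
        refine Finset.mem_filter.2 ⟨hmaps h hh, hr.tail ⟨h, Or.inl hh, rfl, ?_⟩⟩
        exact (hF h (hsub hh)).2.symm
    exact (Finset.mem_filter.1 (hR hf)).2

/-- The positive support of a nonzero integral cycle contains a circuit. -/
theorem IsCycle.exists_isCircuit {c : Γ.E → ℤ} (hc : Γ.IsCycle c) (h0 : c ≠ 0) :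
    ∃ γ, Γ.IsCircuit γ ∧ ∀ e ∈ γ, 0 < c e := by
  suffices H : ∃ γ ⊆ Finset.univ.filter fun e => 0 < c e, Γ.IsCircuit γ by
    obtain ⟨γ, hsub, hγ⟩ := H
    exact ⟨γ, hγ, fun e he => by simpa using hsub he⟩
  refine exists_isCircuit_subset ?_ ?_ ?_
  · obtain ⟨e, he⟩ := Function.ne_iff.1 h0
    rcases lt_or_gt_of_ne he with h | h
    · exact ⟨Γ.inv e, by simpa [hc.1] using h⟩
    · exact ⟨e, by simpa using h⟩
  · intro e he
    simp only [Finset.mem_filter, Finset.mem_univ, true_and] at he ⊢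
    rw [hc.1]
    omega
  · intro e he
    simp only [Finset.mem_filter, Finset.mem_univ, true_and] at he ⊢
    by_contra! H
    refine (Finset.sum_pos' (f := c) (s := Finset.univ.filter fun h => Γ.t h = Γ.t e)
      (fun h hh => ?_) ⟨e, by simp, he⟩).ne' (hc.2 _)
    by_contra! hneg
    refine H (Γ.inv h) (by rw [hc.1]; omega) ?_
    rw [Γ.s_inv]
    simpa using hh

theorem IsCycle.sub {A : Type*} [AddCommGroup A] {a b : Γ.E → A} (ha : Γ.IsCycle a)
    (hb : Γ.IsCycle b) : Γ.IsCycle (a - b) := by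
  refine ⟨fun e => ?_, fun v => ?_⟩
  · simp only [Pi.sub_apply, ha.1, hb.1]
    abel
  · simp only [Pi.sub_apply, Finset.sum_sub_distrib, ha.2, hb.2, sub_zero]

/-- The value of a chain class of a circuit on an edge, when the circuit lies in the positive
support of a cycle. -/
theorem circChainZ_cases {γ : Finset Γ.E} {c : Γ.E → ℤ} (hc : Γ.IsCycle c)
    (hpos : ∀ e ∈ γ, 0 < c e) (e : Γ.E) :
    (e ∈ γ ∧ Γ.circChainZ γ e = 1 ∧ 0 < c e) ∨
      (Γ.inv e ∈ γ ∧ Γ.circChainZ γ e = -1 ∧ c e < 0) ∨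
      (e ∉ γ ∧ Γ.inv e ∉ γ ∧ Γ.circChainZ γ e = 0) := by
  by_cases h1 : e ∈ γ
  · exact Or.inl ⟨h1, by simp [circChainZ, h1], hpos e h1⟩
  · by_cases h2 : Γ.inv e ∈ γ
    · have := hpos _ h2
      rw [hc.1] at this
      exact Or.inr (Or.inl ⟨h2, by simp [circChainZ, h1, h2], by omega⟩)
    · exact Or.inr (Or.inr ⟨h1, h2, by simp [circChainZ, h1, h2]⟩)

theorem exists_sum_circChainZ {T O : Set Γ.E} (hO : Γ.IsOrientation T O) (c : Γ.E → ℤ)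
    (hc : Γ.IsCycle c) (hcO : ∀ e ∈ O, 0 ≤ c e) (hcT : ∀ e ∈ T, c e = 0) :
    ∃ n : Finset Γ.E → ℕ, (∀ γ, n γ ≠ 0 → γ ∈ Γ.Cir T O) ∧
      ∀ e, c e = ∑ γ : Finset Γ.E, (n γ : ℤ) * Γ.circChainZ γ e := by
  induction hN : ∑ e, (c e).natAbs using Nat.strong_induction_on generalizing c with
  | _ N ih =>
  by_cases h0 : c = 0
  · exact ⟨0, by simp, by simp [h0]⟩
  obtain ⟨γ, hγ, hpos⟩ := hc.exists_isCircuit h0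
  have hcases := circChainZ_cases hc hpos
  have hlt : ∑ e, ((c - Γ.circChainZ γ) e).natAbs < N := by
    rw [← hN]
    obtain ⟨e₀, he₀⟩ := hγ.1
    refine Finset.sum_lt_sum (fun e _ => ?_) ⟨e₀, Finset.mem_univ _, ?_⟩
    · have := hcases e
      simp only [Pi.sub_apply]
      omega
    · have h1 : Γ.circChainZ γ e₀ = 1 := by simp [circChainZ, he₀]
      have := hpos e₀ he₀
      simp only [Pi.sub_apply]
      omega
  obtain ⟨n, hn, hsum⟩ := ih _ hlt (c - Γ.circChainZ γ) (hc.sub hγ.isCycle_circChainZ)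
    (fun e he => by
      have := hcases e
      have := hcO e he
      simp only [Pi.sub_apply]
      omega)
    (fun e he => by
      have := hcases e
      have := hcT e he
      simp only [Pi.sub_apply]
      omega) rfl
  have hmem : γ ∈ Γ.Cir T O := by
    have hT : ∀ e ∈ γ, e ∉ T := fun e he h => (hpos e he).ne' (hcT e h)
    refine ⟨hγ, fun e he => (hO.2 e (hT e he)).2 fun h => ?_, hT⟩
    have h1 := hcO _ h
    have h2 := hpos e he
    rw [hc.1] at h1
    omega
  refine ⟨n + Pi.single γ 1, fun δ hδ => ?_, fun e => ?_⟩
  · by_cases h : δ = γ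
    · rwa [h]
    · exact hn δ (by simpa [h] using hδ)
  · have := hsum e
    simp only [Pi.sub_apply] at this
    simp only [Pi.add_apply, Nat.cast_add, add_mul, Finset.sum_add_distrib, ← this]
    rw [Finset.sum_eq_single γ (fun δ _ h => by simp [h]) (by simp)]
    simp

/-- The class of a circuit is not a sum of two nonzero elements of the semigroup. -/
theorem circChainZ_ne_add {T O : Set Γ.E} (hO : Γ.IsOrientation T O) {γ : Finset Γ.E}
    (hγ : γ ∈ Γ.Cir T O) {a b : Γ.E → ℤ}
    (ha : Γ.IsCycle a) (haO : ∀ e ∈ O, 0 ≤ a e) (haT : ∀ e ∈ T, a e = 0)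
    (hb : Γ.IsCycle b) (hbO : ∀ e ∈ O, 0 ≤ b e) (hbT : ∀ e ∈ T, b e = 0)
    (ha0 : a ≠ 0) (hb0 : b ≠ 0) : Γ.circChainZ γ ≠ a + b := by
  intro hab
  obtain ⟨hcirc, hγO, -⟩ := hγ
  have hsupp : ∀ e, e ∉ γ → Γ.inv e ∉ γ → a e = 0 ∧ b e = 0 := by
    intro e h1 h2
    by_cases hT : e ∈ T
    · exact ⟨haT e hT, hbT e hT⟩
    have hsum : a e + b e = 0 := by
      rw [← Pi.add_apply, ← hab]
      simp [circChainZ, h1, h2]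
    by_cases h : e ∈ O
    · have := haO e h
      have := hbO e h
      omega
    · have h' : Γ.inv e ∈ O := not_not.1 fun h' => h ((hO.2 e hT).2 h')
      have h3 := haO _ h'
      have h4 := hbO _ h'
      rw [ha.1] at h3
      rw [hb.1] at h4
      omega
  have hex : ∀ d : Γ.E → ℤ, Γ.IsCycle d → d ≠ 0 → (∀ e, e ∉ γ → Γ.inv e ∉ γ → d e = 0) →
      ∃ e ∈ γ, d e ≠ 0 := by
    intro d hd hd0 hds
    by_contra! H
    refine hd0 (funext fun e => ?_)
    by_cases h1 : e ∈ γ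
    · exact H e h1
    · by_cases h2 : Γ.inv e ∈ γ
      · have := H _ h2
        rw [hd.1] at this
        simpa using this
      · exact hds e h1 h2
  obtain ⟨e, he, hae⟩ := hex a ha ha0 fun e h1 h2 => (hsupp e h1 h2).1
  obtain ⟨f, hf, hbf⟩ := hex b hb hb0 fun e h1 h2 => (hsupp e h1 h2).2
  have hconst : a f = a e := hcirc.eq_of_isCycle ha (fun e h1 h2 => (hsupp e h1 h2).1) he hf
  have hsum : a f + b f = 1 := by
    rw [← Pi.add_apply, ← hab]
    simp [circChainZ, hf]
  have := haO e (hγO e he)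
  have := hbO f (hγO f hf)
  omega

end SerreGraph

/-- For `(T,φ) ∈ OP_Γ`, the classes `[γ]`, `γ ∈ Cir_φ(Γ∖T)`,
form the Hilbert basis of the affine semigroup `C(Γ∖T,φ) = σ(T,φ) ∩ H₁(Γ,ℤ)`:
every element of the semigroup is an `ℕ`-linear combination of them, and no
`[γ]` is a sum of two nonzero elements of the semigroup. -/
theorem stmt16 (Γ : SerreGraph) (p : Set Γ.E × Set Γ.E) (hp : p ∈ Γ.OP) :
    (∀ c : Γ.E → ℤ, Γ.IsCycle c → (∀ e ∈ p.2, 0 ≤ c e) → (∀ e ∈ p.1, c e = 0) →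
      ∃ n : Finset Γ.E → ℕ, (∀ γ, n γ ≠ 0 → γ ∈ Γ.Cir p.1 p.2) ∧
        ∀ e, c e = ∑ γ : Finset Γ.E, (n γ : ℤ) * Γ.circChainZ γ e) ∧
    ∀ γ ∈ Γ.Cir p.1 p.2,
      ¬ ∃ a b : Γ.E → ℤ,
          (Γ.IsCycle a ∧ (∀ e ∈ p.2, 0 ≤ a e) ∧ (∀ e ∈ p.1, a e = 0)) ∧
          (Γ.IsCycle b ∧ (∀ e ∈ p.2, 0 ≤ b e) ∧ (∀ e ∈ p.1, b e = 0)) ∧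
          a ≠ 0 ∧ b ≠ 0 ∧ Γ.circChainZ γ = a + b := by
  obtain ⟨-, hO, -⟩ := hp
  refine ⟨SerreGraph.exists_sum_circChainZ hO, ?_⟩
  rintro γ hγ ⟨a, b, ⟨ha, haO, haT⟩, ⟨hb, hbO, hbT⟩, ha0, hb0, hab⟩
  exact SerreGraph.circChainZ_ne_add hO hγ ha haO haT hb hbO hbT ha0 hb0 hab
end
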